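/- Let K be a number field, φ ∈ K(x) a rational function of degree ≥ 2, and α ∈ K. Then the extension K_∞^{ab}(φ,α)/K, generated by all points of the backward orbit of α lying in abelian extensions of K, is ramified at only finitely many primes of K. -/

import Mathlib

open Polynomial IntermediateField NumberField
open scoped Classical

/-- The self-map of `ℙ¹ = OnePoint F` induced by the rational function `p/q`. -/
noncomputable def onePointMap {F : Type*} [Field F] (p q : Polynomial F) :
    OnePoint F → OnePoint F := fun x =>
  Option.elim x
    (if q.natDegree < p.natDegree then OnePoint.infty
     else OnePoint.some (p.coeff (max p.natDegree q.natDegree) /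
            q.coeff (max p.natDegree q.natDegree)))
    (fun z => if q.eval z = 0 then OnePoint.infty else OnePoint.some (p.eval z / q.eval z))

/-- The backward orbit of `α` under the rational function `p/q`. -/
noncomputable def backOrbit {F : Type*} [Field F] (p q : Polynomial F) (α : F) : Set F :=
  {γ : F | ∃ n : ℕ, 1 ≤ n ∧ (onePointMap p q)^[n] (OnePoint.some γ) = OnePoint.some α}

/-- A maximal ideal `𝔭` of `𝓞 K` ramifies in a (finite) extension `L` of `K` if its
extension to the integral closure of `𝓞 K` in `L` is not squarefree. -/
def IsRamifiedIn (K : Type*) [Field K] [NumberField K]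
    (L : Type*) [Field L] [Algebra K L] (𝔭 : Ideal (𝓞 K)) : Prop :=
  letI : Algebra (𝓞 K) L := ((algebraMap K L).comp (algebraMap (𝓞 K) K)).toAlgebra
  ¬ Squarefree (Ideal.map (algebraMap (𝓞 K) (integralClosure (𝓞 K) L)) 𝔭)

lemma galPow (K L : Type*) [Field K] [NumberField K] [Field L] [NumberField L] [Algebra K L]
    [IsGalois K L] (p : Ideal (𝓞 K)) [p.IsMaximal] (hp : p ≠ ⊥) (P : Ideal (𝓞 L)) [P.IsPrime]
    [P.LiesOver p] :
    Ideal.map (algebraMap (𝓞 K) (𝓞 L)) p =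
      (∏ Q ∈ p.primesOver (𝓞 L), Q) ^ (Nat.card (P.inertia Gal(L/K))) := by
  have : Finite (𝓞 K ⧸ p) := Ideal.finiteQuotientOfFreeOfNeBot p hp
  have : PerfectField p.ResidueField := by infer_instance
  rw [Ideal.map_algebraMap_eq_finsetProd_pow (R := 𝓞 L) hp, ← Finset.prod_pow]
  refine Finset.prod_congr rfl fun Q hQ => ?_
  simp only [Set.mem_toFinset] at hQ
  have := hQ.1
  have := hQ.2
  rw [Ideal.card_inertia_eq_ramificationIdxIn p P, Ideal.ramificationIdxIn_eq_ramificationIdx p Q Gal(L/K)]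

lemma galSqf (K L : Type*) [Field K] [NumberField K] [Field L] [NumberField L] [Algebra K L]
    [IsGalois K L] (p : Ideal (𝓞 K)) [p.IsMaximal] (hp : p ≠ ⊥) (P : Ideal (𝓞 L)) [P.IsPrime]
    [P.LiesOver p] :
    Squarefree (Ideal.map (algebraMap (𝓞 K) (𝓞 L)) p) ↔ Nat.card (P.inertia Gal(L/K)) = 1 := by
  have hQ : ∀ Q ∈ (p.primesOver (𝓞 L)).toFinset, Prime Q := by
    intro Q hQ
    simp only [Set.mem_toFinset] at hQ
    have := hQ.1
    have := hQ.2
    exact Ideal.prime_of_isPrime (Ideal.ne_bot_of_liesOver_of_ne_bot hp Q) hQ.1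
  rw [galPow K L p hp P]
  constructor
  · intro h
    by_contra hne
    have hpos : 0 < Nat.card (P.inertia Gal(L/K)) := Nat.card_pos
    have hP : P ∣ ∏ Q ∈ p.primesOver (𝓞 L), Q :=
      Finset.dvd_prod_of_mem _ (by simp only [Set.mem_toFinset]; exact ⟨inferInstance, inferInstance⟩)
    have : P * P ∣ (∏ Q ∈ p.primesOver (𝓞 L), Q) ^ (Nat.card (P.inertia Gal(L/K))) := by
      rw [← sq]
      exact (pow_dvd_pow_of_dvd hP 2).trans (pow_dvd_pow _ (by omega))
    exact (hQ P (by simp only [Set.mem_toFinset]; exact ⟨inferInstance, inferInstance⟩)).not_isUnit (h P this)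
  · intro h
    rw [h, pow_one]
    refine Finset.squarefree_prod_of_pairwise_isCoprime ?_ fun Q h => (hQ Q h).squarefree
    intro Q hQ1 Q' hQ' hne
    have h1 := hQ Q (by simpa using hQ1)
    have h2 := hQ Q' (by simpa using hQ')
    have m1 := (Ideal.isPrime_of_prime h1).isMaximal h1.ne_zero
    have m2 := (Ideal.isPrime_of_prime h2).isMaximal h2.ne_zero
    exact (Ideal.isCoprime_of_isMaximal (ne := hne)).isRelPrime

open scoped Pointwise in
lemma inertia_all (K L : Type*) [Field K] [NumberField K] [Field L] [NumberField L] [Algebra K L]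
    [IsAbelianGalois K L] (p : Ideal (𝓞 K)) (P Q : Ideal (𝓞 L)) [P.IsPrime]
    [P.LiesOver p] [Q.IsPrime] [Q.LiesOver p] (σ : Gal(L/K)) (hσ : σ ∈ P.inertia Gal(L/K)) :
    σ ∈ Q.inertia Gal(L/K) := by
  obtain ⟨g, rfl⟩ := Ideal.exists_smul_eq_of_isGaloisGroup p P Q Gal(L/K)
  intro x
  have h := hσ (g⁻¹ • x)
  change _ ∈ g • P
  change _ ∈ P at h
  rw [Ideal.mem_pointwise_smul_iff_inv_smul_mem, smul_sub, smul_smul]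
  rwa [smul_smul, mul_comm' σ] at h

lemma exists_loc {R : Type*} [CommRing R] [IsDedekindDomain R] (Q : Ideal R) [Q.IsPrime]
    (x y : R) (h : x ≠ 0 ∨ y ≠ 0) :
    ∃ a b, b ∉ Q ∧ (b * y = a * x ∨ b * x = a * y) := by
  have hI : Ideal.span {x, y} ≠ ⊥ := by
    rw [Ne, Ideal.span_eq_bot]; simp; tauto
  have key : x ∉ Ideal.span {x,y} * Q ∨ y ∉ Ideal.span {x,y} * Q := by
    by_contra! hh
    have h1 : Ideal.span {x,y} ≤ Ideal.span {x,y} * Q := by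
      rw [Ideal.span_le]
      rintro z (rfl | rfl)
      exacts [hh.1, hh.2]
    have h2 : Ideal.span {x,y} * Q ∣ Ideal.span {x,y} * 1 := by
      rw [mul_one]; exact Ideal.dvd_iff_le.2 h1
    have := (mul_dvd_mul_iff_left hI).1 h2
    exact Ideal.IsPrime.ne_top ‹_› (Ideal.isUnit_iff.1 (isUnit_of_dvd_one this))
  have main : ∀ z w : R, z ∈ Ideal.span {x,y} → w ∈ Ideal.span {x,y} → z ∉ Ideal.span {x,y} * Q →
      ∃ a b, b ∉ Q ∧ b * w = a * z := by
    intro z w hz hw hzQ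
    obtain ⟨X, hX⟩ := Ideal.dvd_iff_le.2 ((Ideal.span_singleton_le_iff_mem _).2 hz)
    have : ¬ X ≤ Q := fun hle => hzQ (Ideal.mul_mono_right hle (hX ▸ Ideal.mem_span_singleton_self z))
    obtain ⟨b, hb, hbQ⟩ := SetLike.not_le_iff_exists.1 this
    have : b * w ∈ Ideal.span {z} := by
      rw [hX, mul_comm b w]; exact Ideal.mul_mem_mul hw hb
    obtain ⟨a, ha⟩ := Ideal.mem_span_singleton'.1 this
    exact ⟨a, b, hbQ, ha.symm⟩
  have hx : x ∈ Ideal.span {x,y} := Ideal.subset_span (by simp)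
  have hy : y ∈ Ideal.span {x,y} := Ideal.subset_span (by simp)
  rcases key with k | k
  · obtain ⟨a, b, hb, e⟩ := main x y hx hy k
    exact ⟨a, b, hb, .inl e⟩
  · obtain ⟨a, b, hb, e⟩ := main y x hy hx k
    exact ⟨a, b, hb, .inr e⟩

lemma loc_le {R : Type*} [CommRing R] [IsDedekindDomain R] {G : Type*} [Group G]
    [MulSemiringAction G R] (Q : Ideal R) [Q.IsPrime] (σ : G) (hσ : σ ∈ Q.inertia G)
    (x y : R) (h : x ≠ 0 ∨ y ≠ 0) (M : Ideal R)
    (hM : Ideal.span {x * σ • y - y * σ • x} =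
      Ideal.span {x, y} * Ideal.span {σ • x, σ • y} * M) : M ≤ Q := by
  have hs : ∀ z, σ • z - z ∈ Q := fun z => hσ z
  have hI : Ideal.span {x, y} ≠ ⊥ := by
    rw [Ne, Ideal.span_eq_bot]; simp; tauto
  have hI' : Ideal.span {σ • x, σ • y} ≠ ⊥ := by
    rw [Ne, Ideal.span_eq_bot]; simp [smul_eq_zero_iff_eq]; tauto
  obtain ⟨a, b, hb, hab⟩ := exists_loc Q x y h
  have hσb : σ • b ∉ Q := fun hh => hb (by simpa using Q.sub_mem hh (hs b))
  have hab' : b * σ • a - a * σ • b ∈ Q := by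
    have : b * σ • a - a * σ • b = b * (σ • a - a) - a * (σ • b - b) := by ring
    rw [this]
    exact Q.sub_mem (Q.mul_mem_left _ (hs a)) (Q.mul_mem_left _ (hs b))
  have hmem : (b * σ • b) * (x * σ • y - y * σ • x) ∈
      Ideal.span {x, y} * Ideal.span {σ • x, σ • y} * Q := by
    rcases hab with e | e
    · have e' : σ • b * σ • y = σ • a * σ • x := by rw [← smul_mul', e, smul_mul']
      have : (b * σ • b) * (x * σ • y - y * σ • x) = x * σ • x * (b * σ • a - a * σ • b) := by
        linear_combination b * x * e' - σ • b * σ • x * e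
      rw [this]
      exact Ideal.mul_mem_mul (Ideal.mul_mem_mul (Ideal.subset_span (by simp))
        (Ideal.subset_span (by simp))) hab'
    · have e' : σ • b * σ • x = σ • a * σ • y := by rw [← smul_mul', e, smul_mul']
      have : (b * σ • b) * (x * σ • y - y * σ • x) = y * σ • y * (-(b * σ • a - a * σ • b)) := by
        linear_combination - b * y * e' + σ • b * σ • y * e
      rw [this]
      exact Ideal.mul_mem_mul (Ideal.mul_mem_mul (Ideal.subset_span (by simp))
        (Ideal.subset_span (by simp))) (Q.neg_mem hab')
  rw [← Ideal.span_singleton_le_iff_mem, ← Ideal.span_singleton_mul_span_singleton, hM,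
    mul_left_comm, ← Ideal.dvd_iff_le, mul_dvd_mul_iff_left (mul_ne_zero hI hI'),
    Ideal.dvd_iff_le, Ideal.IsPrime.mul_le ‹_›] at hmem
  rcases hmem with hmem | hmem
  · rw [Ideal.span_singleton_le_iff_mem] at hmem
    exact absurd hmem (Ideal.IsPrime.mul_notMem ‹_› hb hσb)
  · exact hmem

lemma normBound (K L : Type*) [Field K] [NumberField K] [Field L] [NumberField L] [Algebra K L]
    [IsAbelianGalois K L] (p : Ideal (𝓞 K)) [p.IsMaximal] (hp : p ≠ ⊥) (P : Ideal (𝓞 L)) [P.IsPrime]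
    [P.LiesOver p] (σ : Gal(L/K)) (hσ : σ ∈ P.inertia Gal(L/K)) (x y : 𝓞 L)
    (h : x ≠ 0 ∨ y ≠ 0) (hD : x * σ • y - y * σ • x ≠ 0) :
    Ideal.absNorm (Ideal.span {x, y}) ^ 2 * Ideal.absNorm (∏ Q ∈ p.primesOver (𝓞 L), Q) ≤
      Ideal.absNorm (Ideal.span {x * σ • y - y * σ • x}) := by
  have hle : Ideal.span {x * σ • y - y * σ • x} ≤ Ideal.span {x, y} * Ideal.span {σ • x, σ • y} := by
    rw [Ideal.span_singleton_le_iff_mem]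
    refine Ideal.sub_mem _ (Ideal.mul_mem_mul ?_ ?_) (Ideal.mul_mem_mul ?_ ?_) <;>
      exact Ideal.subset_span (by simp)
  obtain ⟨M, hM⟩ := Ideal.dvd_iff_le.2 hle
  have hprod : (∏ Q ∈ p.primesOver (𝓞 L), Q) ∣ M := by
    refine Finset.prod_dvd_of_isRelPrime ?_ ?_
    · intro Q hQ1 Q' hQ' hne
      simp only [Set.coe_toFinset] at hQ1 hQ'
      have := hQ1.1
      have := hQ1.2
      have := hQ'.1
      have := hQ'.2
      have m1 := hQ1.1.isMaximal (Ideal.ne_bot_of_liesOver_of_ne_bot hp Q)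
      have m2 := hQ'.1.isMaximal (Ideal.ne_bot_of_liesOver_of_ne_bot hp Q')
      exact (Ideal.isCoprime_of_isMaximal (ne := hne)).isRelPrime
    · intro Q hQ
      simp only [Set.mem_toFinset] at hQ
      have := hQ.1
      have := hQ.2
      exact Ideal.dvd_iff_le.2 (loc_le Q σ (inertia_all K L p P Q σ hσ) x y h M hM)
  have hn : Ideal.absNorm (Ideal.span {σ • x, σ • y}) = Ideal.absNorm (Ideal.span {x, y}) := by
    have : Ideal.span {σ • x, σ • y} = Ideal.map (MulSemiringAction.toRingEquiv Gal(L/K) (𝓞 L) σ)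
        (Ideal.span {x, y}) := by
      rw [Ideal.map_span, Set.image_pair]; rfl
    rw [this]
    exact (Nat.card_congr (Ideal.quotientEquiv _ _ _ rfl).toEquiv).symm
  rw [hM, map_mul, map_mul, hn, sq]
  have hM0 : M ≠ ⊥ := by
    rintro rfl
    rw [Ideal.mul_bot, Ideal.span_singleton_eq_bot] at hM
    exact hD hM
  refine Nat.mul_le_mul_left _ (Nat.le_of_dvd (Nat.pos_of_ne_zero ?_) (map_dvd _ hprod))
  rwa [Ne, Ideal.absNorm_eq_zero_iff]

/-- Value at `(x,y)` of the degree `n` homogenization of `f`. -/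
noncomputable def hm {R S : Type*} [CommRing R] [CommRing S] (f : R[X]) (n : ℕ) (φ : R →+* S)
    (x y : S) : S := MvPolynomial.eval₂ φ ![x, y] (f.homogenize n)

section hm
variable {R S : Type*} [CommRing R] [CommRing S]

lemma hm_eq_sum (f : R[X]) (n : ℕ) (φ : R →+* S) (x y : S) :
    hm f n φ x y = ∑ i ∈ Finset.range (n + 1), φ (f.coeff i) * (x ^ i * y ^ (n - i)) := by
  unfold hm Polynomial.homogenize
  rw [MvPolynomial.eval₂_sum, Finset.Nat.sum_antidiagonal_eq_sum_range_succ_mk]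
  refine Finset.sum_congr rfl fun i hi => ?_
  rw [MvPolynomial.eval₂_monomial, Finsupp.prod_fintype _ _ (by simp)]
  simp

lemma hm_mul {f g : R[X]} {m n : ℕ} (hf : f.natDegree ≤ m) (hg : g.natDegree ≤ n) (φ : R →+* S)
    (x y : S) : hm (f * g) (m + n) φ x y = hm f m φ x y * hm g n φ x y := by
  unfold hm
  rw [Polynomial.homogenize_mul _ _ hf hg, MvPolynomial.eval₂_mul]

lemma hm_add (f g : R[X]) (n : ℕ) (φ : R →+* S) (x y : S) :
    hm (f + g) n φ x y = hm f n φ x y + hm g n φ x y := by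
  unfold hm
  rw [Polynomial.homogenize_add, MvPolynomial.eval₂_add]

lemma hm_C (c : R) (n : ℕ) (φ : R →+* S) (x y : S) : hm (C c) n φ x y = φ c * y ^ n := by
  unfold hm
  rw [Polynomial.homogenize_C]
  simp

lemma hm_hom {T : Type*} [CommRing T] (f : R[X]) (n : ℕ) (φ : R →+* S) (ψ : S →+* T) (x y : S) :
    ψ (hm f n φ x y) = hm f n (ψ.comp φ) (ψ x) (ψ y) := by
  simp [hm_eq_sum]

lemma hm_map {T : Type*} [CommRing T] (f : R[X]) (n : ℕ) (φ : R →+* S) (ψ : S →+* T) (x y : T) :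
    hm (f.map φ) n ψ x y = hm f n (ψ.comp φ) x y := by
  simp [hm_eq_sum]

lemma hm_swap (f : R[X]) (n : ℕ) (φ : R →+* S) (x y : S) :
    hm (f.reflect n) n φ y x = hm f n φ x y := by
  rw [hm_eq_sum, hm_eq_sum, ← Finset.sum_range_reflect]
  refine Finset.sum_congr rfl fun i hi => ?_
  have hi : i ≤ n := by simpa [Nat.lt_succ_iff] using hi
  have h1 : n + 1 - 1 - i = n - i := by omega
  have h2 : n - (n - i) = i := by omega
  rw [h1, h2, Polynomial.coeff_reflect, Polynomial.revAt_le (by omega), h2]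
  ring

lemma hm_infty (f : R[X]) (n : ℕ) (φ : R →+* S) (x : S) :
    hm f n φ x 0 = φ (f.coeff n) * x ^ n := by
  rw [← hm_swap, hm_eq_sum, Finset.sum_eq_single 0]
  · simp [Polynomial.coeff_reflect]
  · intro b _ hb; simp [hb]
  · simp

lemma hm_eval {S : Type*} [Field S] {f : R[X]} {n : ℕ} (hf : f.natDegree ≤ n) (φ : R →+* S)
    (x y : S) (hy : y ≠ 0) : hm f n φ x y = y ^ n * (f.map φ).eval (x / y) := by
  rw [hm_eq_sum, Polynomial.eval_map, Polynomial.eval₂_eq_sum_range' _ (Nat.lt_succ_of_le hf),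
    Finset.mul_sum]
  refine Finset.sum_congr rfl fun i hi => ?_
  have hi : i ≤ n := by simpa [Nat.lt_succ_iff] using hi
  obtain ⟨k, rfl⟩ := Nat.exists_eq_add_of_le hi
  rw [Nat.add_sub_cancel_left]
  rw [div_pow, pow_add]
  field_simp

lemma hm_mem (f : R[X]) (n : ℕ) (φ : R →+* S) (x y : S) (I : Ideal S) (hx : x ∈ I) (hy : y ∈ I) :
    hm f n φ x y ∈ I ^ n := by
  rw [hm_eq_sum]
  refine Ideal.sum_mem _ fun i hi => Ideal.mul_mem_left _ _ ?_
  have hi : i ≤ n := by simpa [Nat.lt_succ_iff] using hi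
  have := Ideal.mul_mem_mul (Ideal.pow_mem_pow hx i) (Ideal.pow_mem_pow hy (n - i))
  rwa [← pow_add, Nat.add_sub_cancel' hi] at this

lemma hm_norm_le (f : R[X]) (n : ℕ) (φ : R →+* ℂ) :
    ∃ B : ℝ, 0 ≤ B ∧ ∀ x y, ‖hm f n φ x y‖ ≤ B * max ‖x‖ ‖y‖ ^ n := by
  refine ⟨∑ i ∈ Finset.range (n + 1), ‖φ (f.coeff i)‖, Finset.sum_nonneg fun _ _ => norm_nonneg _,
    fun x y => ?_⟩
  rw [hm_eq_sum, Finset.sum_mul]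
  refine (norm_sum_le _ _).trans (Finset.sum_le_sum fun i hi => ?_)
  have hi : i ≤ n := by simpa [Nat.lt_succ_iff] using hi
  rw [norm_mul, norm_mul, norm_pow, norm_pow]
  gcongr
  calc ‖x‖ ^ i * ‖y‖ ^ (n - i) ≤ max ‖x‖ ‖y‖ ^ i * max ‖x‖ ‖y‖ ^ (n - i) := by
        gcongr
        · exact le_max_left _ _
        · exact le_max_right _ _
    _ = _ := by rw [← pow_add, Nat.add_sub_cancel' hi]

/-- Integral certificate that two degree `d` forms have no common zero. -/
structure Cert (p q : R[X]) (d : ℕ) where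
  hp : p.natDegree ≤ d
  hq : q.natDegree ≤ d
  e : ℕ
  r : R
  r0 : r ≠ 0
  U : R[X]
  V : R[X]
  U' : R[X]
  V' : R[X]
  hU : U.natDegree ≤ e
  hV : V.natDegree ≤ e
  hU' : U'.natDegree ≤ e
  hV' : V'.natDegree ≤ e
  h : U * p + V * q = C r
  h' : U' * p.reflect d + V' * q.reflect d = C r

lemma natDegree_reflect_le' (f : R[X]) (d : ℕ) (h : f.natDegree ≤ d) :
    (f.reflect d).natDegree ≤ d := by
  rw [Polynomial.natDegree_le_iff_coeff_eq_zero]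
  intro N hN
  rw [Polynomial.coeff_reflect, Polynomial.revAt_eq_self_of_lt hN]
  exact Polynomial.coeff_eq_zero_of_natDegree_lt (by omega)

lemma Cert.id1 {p q : R[X]} {d : ℕ} (c : Cert p q d) (φ : R →+* S) (x y : S) :
    hm c.U c.e φ x y * hm p d φ x y + hm c.V c.e φ x y * hm q d φ x y = φ c.r * y ^ (c.e + d) := by
  rw [← hm_mul c.hU c.hp, ← hm_mul c.hV c.hq, ← hm_add, c.h, hm_C]

lemma Cert.id2 {p q : R[X]} {d : ℕ} (c : Cert p q d) (φ : R →+* S) (x y : S) :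
    hm c.U' c.e φ y x * hm p d φ x y + hm c.V' c.e φ y x * hm q d φ x y = φ c.r * x ^ (c.e + d) := by
  rw [← hm_swap p, ← hm_swap q, ← hm_mul c.hU' (natDegree_reflect_le' _ _ c.hp),
    ← hm_mul c.hV' (natDegree_reflect_le' _ _ c.hq), ← hm_add, c.h', hm_C]

lemma Cert.arch1 [IsDomain R] {p q : R[X]} {d : ℕ} (c : Cert p q d) (φ : R →+* ℂ)
    (hφ : Function.Injective φ) (hd : 0 < d) :
    ∃ B : ℝ, 0 < B ∧ ∀ x y, max ‖x‖ ‖y‖ ^ d ≤ B * max ‖hm p d φ x y‖ ‖hm q d φ x y‖ := by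
  obtain ⟨B1, h1, H1⟩ := hm_norm_le c.U c.e φ
  obtain ⟨B2, h2, H2⟩ := hm_norm_le c.V c.e φ
  obtain ⟨B3, h3, H3⟩ := hm_norm_le c.U' c.e φ
  obtain ⟨B4, h4, H4⟩ := hm_norm_le c.V' c.e φ
  have hr : 0 < ‖φ c.r‖ := norm_pos_iff.2 ((map_ne_zero_iff _ hφ).2 c.r0)
  refine ⟨(B1 + B2 + B3 + B4 + 1) / ‖φ c.r‖, by positivity, fun x y => ?_⟩
  set m := max ‖x‖ ‖y‖ with hmm
  set M := max ‖hm p d φ x y‖ ‖hm q d φ x y‖ with hM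
  have hM0 : 0 ≤ M := (norm_nonneg _).trans (le_max_left _ _)
  have hm0 : 0 ≤ m := (norm_nonneg _).trans (le_max_left _ _)
  have k1 : ‖φ c.r‖ * ‖y‖ ^ (c.e + d) ≤ (B1 + B2 + B3 + B4 + 1) * m ^ c.e * M := by
    rw [← norm_pow, ← norm_mul, ← c.id1 φ x y]
    refine (norm_add_le _ _).trans ?_
    rw [norm_mul, norm_mul]
    calc _ ≤ (B1 * m ^ c.e) * M + (B2 * m ^ c.e) * M := by
          gcongr
          · exact H1 x y
          · exact le_max_left _ _
          · exact H2 x y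
          · exact le_max_right _ _
      _ ≤ _ := by
        have : 0 ≤ m ^ c.e * M := by positivity
        nlinarith
  have k2 : ‖φ c.r‖ * ‖x‖ ^ (c.e + d) ≤ (B1 + B2 + B3 + B4 + 1) * m ^ c.e * M := by
    rw [← norm_pow, ← norm_mul, ← c.id2 φ x y]
    refine (norm_add_le _ _).trans ?_
    rw [norm_mul, norm_mul]
    calc _ ≤ (B3 * m ^ c.e) * M + (B4 * m ^ c.e) * M := by
          gcongr
          · exact (H3 y x).trans_eq (by rw [max_comm])
          · exact le_max_left _ _
          · exact (H4 y x).trans_eq (by rw [max_comm])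
          · exact le_max_right _ _
      _ ≤ _ := by
        have : 0 ≤ m ^ c.e * M := by positivity
        nlinarith
  have k : ‖φ c.r‖ * m ^ (c.e + d) ≤ (B1 + B2 + B3 + B4 + 1) * m ^ c.e * M := by
    rcases max_choice ‖x‖ ‖y‖ with h | h <;> rw [hmm, h] <;> rw [← h, ← hmm]
    · rw [← h, ← hmm] at k2; exact k2
    · rw [← h, ← hmm] at k1; exact k1
  rcases hm0.eq_or_lt with h0 | h0
  · rw [← h0, zero_pow hd.ne']; positivity
  · rw [div_mul_eq_mul_div, le_div_iff₀ hr]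
    have : 0 < m ^ c.e := by positivity
    rw [pow_add] at k
    refine le_of_mul_le_mul_left ?_ this
    linarith

end hm

lemma cert_field {K : Type*} [Field K] (p q : K[X]) (hcop : IsCoprime p q) :
    ∃ U V U' V' : K[X], U * p + V * q = 1 ∧
      U' * p.reflect (max p.natDegree q.natDegree) + V' * q.reflect (max p.natDegree q.natDegree) = 1 := by
  obtain ⟨U, V, h⟩ := hcop
  set d := max p.natDegree q.natDegree with hd
  have hpd : p.natDegree ≤ d := le_max_left _ _
  have hqd : q.natDegree ≤ d := le_max_right _ _
  set e := max U.natDegree V.natDegree with he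
  have hUe : U.natDegree ≤ e := le_max_left _ _
  have hVe : V.natDegree ≤ e := le_max_right _ _
  have key : U.reflect e * p.reflect d + V.reflect e * q.reflect d = X ^ (e + d) := by
    rw [← Polynomial.reflect_mul _ _ hUe hpd, ← Polynomial.reflect_mul _ _ hVe hqd,
      ← Polynomial.reflect_add, h, Polynomial.reflect_one]
  have hc : p.coeff d ≠ 0 ∨ q.coeff d ≠ 0 := by
    by_contra! hh
    rcases max_choice p.natDegree q.natDegree with hm | hm
    · rw [hd, hm, Polynomial.coeff_natDegree, Polynomial.leadingCoeff_eq_zero] at hh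
      have h0 := hh.1
      have : q.natDegree = 0 := by rw [h0] at hm; simpa using hm
      obtain ⟨hp0, hq⟩ := hh
      rw [hp0, Polynomial.natDegree_zero] at hq
      rw [Polynomial.eq_C_of_natDegree_eq_zero this, hq, hp0] at h
      simp at h
    · rw [hd, hm, Polynomial.coeff_natDegree, Polynomial.leadingCoeff_eq_zero] at hh
      have h0 := hh.2
      have : p.natDegree = 0 := by rw [h0] at hm; simpa using hm
      obtain ⟨hp, hq0⟩ := hh
      rw [hq0, Polynomial.natDegree_zero] at hp
      rw [Polynomial.eq_C_of_natDegree_eq_zero this, hp, hq0] at h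
      simp at h
  have aux : ∀ f : K[X], f.coeff d ≠ 0 → IsCoprime (X ^ (e + d)) (f.reflect d) := by
    intro f hf
    refine IsCoprime.pow_left ?_
    refine (Polynomial.irreducible_X.coprime_iff_not_dvd).2 ?_
    rw [Polynomial.X_dvd_iff, Polynomial.coeff_reflect]
    simpa using hf
  have hfin : IsCoprime (p.reflect d) (q.reflect d) := by
    rcases hc with hc | hc
    · have := (aux p hc).symm
      rw [← key, add_comm, IsCoprime.add_mul_right_right_iff] at this
      exact this.of_mul_right_right
    · have := (aux q hc).symm
      rw [← key, IsCoprime.add_mul_right_right_iff] at this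
      exact this.of_mul_right_right.symm
  obtain ⟨U', V', h'⟩ := hfin
  exact ⟨U, V, U', V', h, h'⟩

lemma exists_int {K : Type*} [Field K] [NumberField K] (f : K[X]) :
    ∃ m : 𝓞 K, m ≠ 0 ∧ ∃ g : (𝓞 K)[X], g.map (algebraMap (𝓞 K) K) = C (algebraMap (𝓞 K) K m) * f := by
  obtain ⟨b, hb, h⟩ := IsLocalization.integerNormalization_spec (nonZeroDivisors (𝓞 K)) f
  refine ⟨b, nonZeroDivisors.ne_zero hb, _, h.trans ?_⟩
  ext i
  rw [Polynomial.coeff_smul, Polynomial.coeff_C_mul, Algebra.smul_def]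

lemma reflect_C_mul' {R : Type*} [CommRing R] (c : R) (f : R[X]) (n : ℕ) :
    (C c * f).reflect n = C c * f.reflect n := by
  ext i; simp [Polynomial.coeff_reflect]

lemma reflect_map' {R S : Type*} [CommRing R] [CommRing S] (φ : R →+* S) (f : R[X]) (n : ℕ) :
    (f.map φ).reflect n = (f.reflect n).map φ := by
  ext i; simp [Polynomial.coeff_reflect]

lemma exists_cert {K : Type*} [Field K] [NumberField K] (p q : K[X]) (hcop : IsCoprime p q) :
    ∃ m : 𝓞 K, m ≠ 0 ∧ ∃ p0 q0 : (𝓞 K)[X],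
      p0.map (algebraMap (𝓞 K) K) = C (algebraMap (𝓞 K) K m) * p ∧
      q0.map (algebraMap (𝓞 K) K) = C (algebraMap (𝓞 K) K m) * q ∧
      Nonempty (Cert p0 q0 (max p.natDegree q.natDegree)) := by
  obtain ⟨U, V, U', V', h, h'⟩ := cert_field p q hcop
  set d := max p.natDegree q.natDegree with hd
  set j := algebraMap (𝓞 K) K with hj
  have hinj : Function.Injective j := RingOfIntegers.coe_injective
  obtain ⟨m1, hm1, p1, hp1⟩ := exists_int p
  obtain ⟨m2, hm2, q1, hq1⟩ := exists_int q
  obtain ⟨k1, hk1, U1, hU1⟩ := exists_int U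
  obtain ⟨k2, hk2, V1, hV1⟩ := exists_int V
  obtain ⟨k3, hk3, U2, hU2⟩ := exists_int U'
  obtain ⟨k4, hk4, V2, hV2⟩ := exists_int V'
  rw [← hj] at hp1 hq1 hU1 hV1 hU2 hV2
  have hp0 : (C m2 * p1).map j = C (j (m1 * m2)) * p := by
    rw [Polynomial.map_mul, hp1, Polynomial.map_C, map_mul, C_mul]; ring
  have hq0 : (C m1 * q1).map j = C (j (m1 * m2)) * q := by
    rw [Polynomial.map_mul, hq1, Polynomial.map_C, map_mul, C_mul]; ring
  have hdeg : ∀ (f : (𝓞 K)[X]) (c : 𝓞 K) (g : K[X]), f.map j = C (j c) * g → g.natDegree ≤ d →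
      f.natDegree ≤ d := by
    intro f c g h hg
    rw [← Polynomial.natDegree_map_eq_of_injective hinj, h]
    exact (Polynomial.natDegree_C_mul_le _ _).trans hg
  refine ⟨m1 * m2, mul_ne_zero hm1 hm2, C m2 * p1, C m1 * q1, hp0, hq0, ⟨?_⟩⟩
  refine
    { hp := hdeg _ _ _ hp0 (le_max_left _ _)
      hq := hdeg _ _ _ hq0 (le_max_right _ _)
      e := max (max (C (k2 * k3 * k4) * U1).natDegree (C (k1 * k3 * k4) * V1).natDegree)
        (max (C (k1 * k2 * k4) * U2).natDegree (C (k1 * k2 * k3) * V2).natDegree)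
      r := (k1 * k2 * k3 * k4) * (m1 * m2)
      r0 := by simp [*]
      U := C (k2 * k3 * k4) * U1
      V := C (k1 * k3 * k4) * V1
      U' := C (k1 * k2 * k4) * U2
      V' := C (k1 * k2 * k3) * V2
      hU := le_max_of_le_left (le_max_left _ _)
      hV := le_max_of_le_left (le_max_right _ _)
      hU' := le_max_of_le_right (le_max_left _ _)
      hV' := le_max_of_le_right (le_max_right _ _)
      h := ?_
      h' := ?_ }
  · apply Polynomial.map_injective j hinj
    rw [Polynomial.map_add, Polynomial.map_mul, Polynomial.map_mul j (p := _ * V1), hp0, hq0]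
    simp only [Polynomial.map_mul, Polynomial.map_C, hU1, hV1, map_mul]
    linear_combination (C (j k1) * C (j k2) * C (j k3) * C (j k4) * (C (j m1) * C (j m2))) * h
  · apply Polynomial.map_injective j hinj
    rw [Polynomial.map_add, Polynomial.map_mul, Polynomial.map_mul j (p := _ * V2), ← reflect_map', ← reflect_map',
      hp0, hq0, reflect_C_mul', reflect_C_mul']
    simp only [Polynomial.map_mul, Polynomial.map_C, hU2, hV2, map_mul]
    linear_combination (C (j k1) * C (j k2) * C (j k3) * C (j k4) * (C (j m1) * C (j m2))) * h'

lemma span_pow_pair {R : Type*} [CommRing R] [IsDedekindDomain R] (x y : R) (n : ℕ) :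
    Ideal.span {x, y} ^ n = Ideal.span {x ^ n, y ^ n} := by
  by_cases h0 : Ideal.span {x, y} = ⊥
  · rw [h0]
    rw [Ideal.span_eq_bot] at h0
    have hx : x = 0 := h0 x (by simp)
    have hy : y = 0 := h0 y (by simp)
    subst hx hy
    rcases Nat.eq_zero_or_pos n with rfl | hn
    · simp
    · rw [zero_pow hn.ne', ← Ideal.zero_eq_bot, zero_pow hn.ne']; simp
  · obtain ⟨A, hA⟩ := Ideal.dvd_iff_le.2 ((Ideal.span_singleton_le_iff_mem (I := Ideal.span {x, y})).2
      (Ideal.subset_span (show x ∈ ({x, y} : Set R) by simp)))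
    obtain ⟨B, hB⟩ := Ideal.dvd_iff_le.2 ((Ideal.span_singleton_le_iff_mem (I := Ideal.span {x, y})).2
      (Ideal.subset_span (show y ∈ ({x, y} : Set R) by simp)))
    have hcop : A ⊔ B = 1 := by
      apply mul_left_cancel₀ h0
      rw [Ideal.mul_sup, ← hA, ← hB, mul_one, Ideal.span_insert]
    have hc : IsCoprime A B := Ideal.isCoprime_iff_sup_eq.2 (hcop.trans Ideal.one_eq_top)
    have hc' := Ideal.isCoprime_iff_sup_eq.1 (hc.pow (m := n) (n := n))
    rw [Ideal.span_insert (x ^ n), ← Ideal.span_singleton_pow, ← Ideal.span_singleton_pow, hA, hB, mul_pow, mul_pow,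
      ← Ideal.mul_sup, hc', Ideal.mul_top]

lemma Cert.fin {R S : Type*} [CommRing R] [CommRing S] [IsDedekindDomain S]
    {p q : R[X]} {d : ℕ} (c : Cert p q d) (φ : R →+* S) (x y : S) (h : x ≠ 0 ∨ y ≠ 0) :
    Ideal.span {φ c.r} * Ideal.span {x, y} ^ d ≤ Ideal.span {hm p d φ x y, hm q d φ x y} := by
  have hI : Ideal.span {x, y} ≠ ⊥ := by
    rw [Ne, Ideal.span_eq_bot]; simp; tauto
  have hx : x ∈ Ideal.span {x,y} := Ideal.subset_span (by simp)
  have hy : y ∈ Ideal.span {x,y} := Ideal.subset_span (by simp)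
  rw [← Ideal.dvd_iff_le, ← mul_dvd_mul_iff_left (pow_ne_zero c.e hI), mul_left_comm, ← pow_add,
    span_pow_pair x y (c.e + d), Ideal.dvd_iff_le, Ideal.span_mul_span', Ideal.span_le]
  have hp : hm p d φ x y ∈ Ideal.span {hm p d φ x y, hm q d φ x y} := Ideal.subset_span (by simp)
  have hq : hm q d φ x y ∈ Ideal.span {hm p d φ x y, hm q d φ x y} := Ideal.subset_span (by simp)
  rintro _ ⟨a, ha, b, hb, rfl⟩
  simp only [Set.mem_singleton_iff] at ha
  subst ha
  simp only [SetLike.mem_coe]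
  rcases hb with rfl | rfl
  · rw [← c.id2]
    exact Ideal.add_mem _ (Ideal.mul_mem_mul (hm_mem _ _ _ _ _ _ hy hx) hp)
      (Ideal.mul_mem_mul (hm_mem _ _ _ _ _ _ hy hx) hq)
  · rw [← c.id1]
    exact Ideal.add_mem _ (Ideal.mul_mem_mul (hm_mem _ _ _ _ _ _ hx hy) hp)
      (Ideal.mul_mem_mul (hm_mem _ _ _ _ _ _ hx hy) hq)

/-- Archimedean part of the height of `(x : y)`. -/
noncomputable def Amax {L : Type*} [Field L] [NumberField L] (x y : 𝓞 L) : ℝ :=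
  ∏ τ : L →+* ℂ, max ‖τ x‖ ‖τ y‖

lemma absNorm_eq_prod {L : Type*} [Field L] [NumberField L] (z : 𝓞 L) :
    (Ideal.absNorm (Ideal.span {z}) : ℝ) = ∏ τ : L →+* ℂ, ‖τ z‖ := by
  rw [Ideal.absNorm_span_singleton]
  have h := Algebra.norm_eq_prod_embeddings ℚ ℂ (z : L)
  have h1 : ‖algebraMap ℚ ℂ (Algebra.norm ℚ (z : L))‖ = ((Algebra.norm ℤ z).natAbs : ℝ) := by
    rw [← Algebra.coe_norm_int]
    simp
  rw [← h1, h, norm_prod]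
  exact (Fintype.prod_equiv (RingHom.equivRatAlgHom L ℂ) _ _ fun τ => rfl).symm

lemma Amax_nonneg {L : Type*} [Field L] [NumberField L] (x y : 𝓞 L) : 0 ≤ Amax x y :=
  Finset.prod_nonneg fun _ _ => (norm_nonneg _).trans (le_max_left _ _)

lemma prod_const_emb (L : Type*) [Field L] [NumberField L] (B : ℝ) :
    ∏ _τ : L →+* ℂ, B = B ^ Module.finrank ℚ L := by
  rw [Finset.prod_const, Finset.card_univ, Embeddings.card]

lemma exists_step {K : Type*} [Field K] [NumberField K] {p q : (𝓞 K)[X]} {d : ℕ}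
    (c : Cert p q d) (hd : 0 < d) :
    ∃ B : ℝ, 1 ≤ B ∧ ∀ (L : Type*) [Field L] [NumberField L] [Algebra K L] (x y : 𝓞 L),
      x ≠ 0 ∨ y ≠ 0 →
      Amax x y ^ d * Ideal.absNorm (Ideal.span {hm p d (algebraMap (𝓞 K) (𝓞 L)) x y,
          hm q d (algebraMap (𝓞 K) (𝓞 L)) x y}) ≤
        B ^ Module.finrank ℚ L * Amax (hm p d (algebraMap (𝓞 K) (𝓞 L)) x y)
          (hm q d (algebraMap (𝓞 K) (𝓞 L)) x y) * Ideal.absNorm (Ideal.span {x, y}) ^ d := by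
  have h1 : ∀ ρ : K →+* ℂ, ∃ B : ℝ, 0 < B ∧ ∀ x y, max ‖x‖ ‖y‖ ^ d ≤
      B * max ‖hm p d (ρ.comp (algebraMap (𝓞 K) K)) x y‖ ‖hm q d (ρ.comp (algebraMap (𝓞 K) K)) x y‖ :=
    fun ρ => c.arch1 _ (ρ.injective.comp RingOfIntegers.coe_injective) hd
  choose B hB0 hB using h1
  refine ⟨(1 + ∑ ρ, B ρ) * (1 + ∑ ρ : K →+* ℂ, ‖ρ c.r‖), ?_, ?_⟩
  · have h1 : 0 ≤ ∑ ρ, B ρ := Finset.sum_nonneg fun ρ _ => (hB0 ρ).le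
    have h2 : 0 ≤ ∑ ρ : K →+* ℂ, ‖ρ c.r‖ := Finset.sum_nonneg fun ρ _ => norm_nonneg _
    nlinarith
  intro L _ _ _ x y hxy
  set F := hm p d (algebraMap (𝓞 K) (𝓞 L)) x y with hF
  set G := hm q d (algebraMap (𝓞 K) (𝓞 L)) x y with hG
  have hI : Ideal.span {x, y} ≠ ⊥ := by
    rw [Ne, Ideal.span_eq_bot]; simp; tauto
  have e1 : Amax x y ^ d ≤ (1 + ∑ ρ, B ρ) ^ Module.finrank ℚ L * Amax F G := by
    unfold Amax
    rw [← prod_const_emb L, ← Finset.prod_mul_distrib, ← Finset.prod_pow]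
    refine Finset.prod_le_prod (fun τ _ => by positivity) fun τ _ => ?_
    have := hB (τ.comp (algebraMap K L)) (τ x) (τ y)
    have hcomp : (τ.comp (algebraMap K L)).comp (algebraMap (𝓞 K) K) =
        (τ.comp (algebraMap (𝓞 L) L)).comp (algebraMap (𝓞 K) (𝓞 L)) := by
      ext z; rfl
    rw [hcomp] at this
    have kF := hm_hom p d (algebraMap (𝓞 K) (𝓞 L)) (τ.comp (algebraMap (𝓞 L) L)) x y
    have kG := hm_hom q d (algebraMap (𝓞 K) (𝓞 L)) (τ.comp (algebraMap (𝓞 L) L)) x y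
    simp only [RingHom.comp_apply] at kF kG
    rw [← kF, ← kG] at this
    refine this.trans ?_
    gcongr
    have := Finset.single_le_sum (f := B) (fun ρ _ => (hB0 ρ).le) (Finset.mem_univ (τ.comp (algebraMap K L)))
    linarith
  have e2 : (Ideal.absNorm (Ideal.span {F, G}) : ℝ) ≤
      (1 + ∑ ρ : K →+* ℂ, ‖ρ c.r‖) ^ Module.finrank ℚ L * Ideal.absNorm (Ideal.span {x, y}) ^ d := by
    have hle := c.fin (algebraMap (𝓞 K) (𝓞 L)) x y hxy
    have hr : algebraMap (𝓞 K) (𝓞 L) c.r ≠ 0 :=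
      (map_ne_zero_iff _ (FaithfulSMul.algebraMap_injective _ _)).2 c.r0
    have hN := Nat.le_of_dvd (Nat.pos_of_ne_zero (by
      rw [Ne, Ideal.absNorm_eq_zero_iff]
      refine mul_ne_zero ?_ (pow_ne_zero d hI)
      rwa [Ne, Ideal.zero_eq_bot, Ideal.span_singleton_eq_bot])) (Ideal.absNorm_dvd_absNorm_of_le hle)
    rw [map_mul, map_pow] at hN
    refine (Nat.cast_le (α := ℝ).2 hN).trans ?_
    push_cast
    gcongr
    rw [absNorm_eq_prod, ← prod_const_emb L]
    refine Finset.prod_le_prod (fun τ _ => by positivity) fun τ _ => ?_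
    have := Finset.single_le_sum (f := fun ρ : K →+* ℂ => ‖ρ c.r‖) (fun ρ _ => norm_nonneg _) (Finset.mem_univ (τ.comp (algebraMap K L)))
    have h2 : τ (algebraMap (𝓞 K) (𝓞 L) c.r) = (τ.comp (algebraMap K L)) c.r := rfl
    rw [h2]
    linarith
  calc _ ≤ ((1 + ∑ ρ, B ρ) ^ Module.finrank ℚ L * Amax F G) *
        ((1 + ∑ ρ : K →+* ℂ, ‖ρ c.r‖) ^ Module.finrank ℚ L * Ideal.absNorm (Ideal.span {x, y}) ^ d) :=
        mul_le_mul e1 e2 (by positivity) ((pow_nonneg (Amax_nonneg _ _) _).trans e1)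
    _ = _ := by rw [mul_pow]; ring

/-- `(x : y)` are homogeneous coordinates of `P`. -/
def HRep {L Ω : Type*} [Field L] [Field Ω] [Algebra L Ω] (x y : 𝓞 L) (P : OnePoint Ω) : Prop :=
  (y = 0 ∧ x ≠ 0 ∧ P = OnePoint.infty) ∨
    (y ≠ 0 ∧ P = OnePoint.some (algebraMap L Ω x / algebraMap L Ω y))

lemma HRep.ne {L Ω : Type*} [Field L] [Field Ω] [Algebra L Ω] {x y : 𝓞 L} {P : OnePoint Ω}
    (h : HRep x y P) : x ≠ 0 ∨ y ≠ 0 := by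
  unfold HRep at h; tauto

lemma rep_step {K L Ω : Type*} [Field K] [NumberField K] [Field L] [NumberField L] [Algebra K L]
    [Field Ω] [Algebra L Ω] [Algebra K Ω] [IsScalarTower K L Ω]
    (p q : K[X]) (m : 𝓞 K) (hm0 : m ≠ 0) (p0 q0 : (𝓞 K)[X])
    (hp0 : p0.map (algebraMap (𝓞 K) K) = C (algebraMap (𝓞 K) K m) * p)
    (hq0 : q0.map (algebraMap (𝓞 K) K) = C (algebraMap (𝓞 K) K m) * q)
    (c : Cert p0 q0 (max p.natDegree q.natDegree)) (hd : 0 < max p.natDegree q.natDegree)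
    (x y : 𝓞 L) (P : OnePoint Ω) (hP : HRep x y P) :
    HRep (hm p0 (max p.natDegree q.natDegree) (algebraMap (𝓞 K) (𝓞 L)) x y)
      (hm q0 (max p.natDegree q.natDegree) (algebraMap (𝓞 K) (𝓞 L)) x y)
      (onePointMap (p.map (algebraMap K Ω)) (q.map (algebraMap K Ω)) P) := by
  have hne := hP.ne
  set d := max p.natDegree q.natDegree with hd'
  set F := hm p0 d (algebraMap (𝓞 K) (𝓞 L)) x y with hF
  set G := hm q0 d (algebraMap (𝓞 K) (𝓞 L)) x y with hG
  have hr : algebraMap (𝓞 K) (𝓞 L) c.r ≠ 0 :=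
    (map_ne_zero_iff _ (FaithfulSMul.algebraMap_injective _ _)).2 c.r0
  have hFG : F ≠ 0 ∨ G ≠ 0 := by
    by_contra! hh
    have i1 := c.id1 (algebraMap (𝓞 K) (𝓞 L)) x y
    have i2 := c.id2 (algebraMap (𝓞 K) (𝓞 L)) x y
    rw [← hF, ← hG, hh.1, hh.2] at i1 i2
    simp [hr] at i1 i2
    tauto
  let j : 𝓞 L →+* Ω := (algebraMap L Ω).comp (algebraMap (𝓞 L) L)
  have hj : Function.Injective j := (algebraMap L Ω).injective.comp RingOfIntegers.coe_injective
  have hj0 : ∀ z, j z = 0 ↔ z = 0 := fun z => map_eq_zero_iff _ hj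
  let M : Ω := algebraMap K Ω m
  have hM : M ≠ 0 := by
    simp only [M]
    rw [Ne, map_eq_zero]
    exact_mod_cast hm0
  have hcomp : j.comp (algebraMap (𝓞 K) (𝓞 L)) = (algebraMap K Ω).comp (algebraMap (𝓞 K) K) := by
    ext z
    simp only [j, RingHom.comp_apply]
    rw [IsScalarTower.algebraMap_apply K L Ω]
    rfl
  have main : ∀ (f : K[X]) (f0 : (𝓞 K)[X]),
      f0.map (algebraMap (𝓞 K) K) = C (algebraMap (𝓞 K) K m) * f → f.natDegree ≤ d →
      j (hm f0 d (algebraMap (𝓞 K) (𝓞 L)) x y) = M * hm f d (algebraMap K Ω) (j x) (j y) := by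
    intro f f0 hf0 hfd
    rw [hm_hom, hcomp, ← hm_map, hf0]
    have := hm_mul (S := Ω) (f := C (algebraMap (𝓞 K) K m)) (g := f) (m := 0) (by simp) hfd (algebraMap K Ω) (j x) (j y)
    rw [zero_add] at this
    rw [this, hm_C]
    simp [M]
  have jF : j F = M * hm p d (algebraMap K Ω) (j x) (j y) := main p p0 hp0 (le_max_left _ _)
  have jG : j G = M * hm q d (algebraMap K Ω) (j x) (j y) := main q q0 hq0 (le_max_right _ _)
  have jFG : algebraMap L Ω F / algebraMap L Ω G = hm p d (algebraMap K Ω) (j x) (j y) /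
      hm q d (algebraMap K Ω) (j x) (j y) := by
    change j F / j G = _
    rw [jF, jG, mul_div_mul_left _ _ hM]
  have hG0 : G = 0 ↔ hm q d (algebraMap K Ω) (j x) (j y) = 0 := by
    rw [← hj0, jG, mul_eq_zero, or_iff_right hM]
  unfold HRep
  rw [jFG, show (G ≠ 0) ↔ _ from not_congr hG0, hG0]
  rcases hP with ⟨hy, hx, rfl⟩ | ⟨hy, rfl⟩
  · have hx' : j x ≠ 0 := fun h => hx ((hj0 x).1 h)
    have e : onePointMap (p.map (algebraMap K Ω)) (q.map (algebraMap K Ω)) OnePoint.infty =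
      if q.natDegree < p.natDegree then OnePoint.infty else
        OnePoint.some (algebraMap K Ω (p.coeff d) / algebraMap K Ω (q.coeff d)) := by
      change (if _ then _ else _) = _
      simp only [Polynomial.natDegree_map, Polynomial.coeff_map, hd']
    rw [e, hy, map_zero, hm_infty, hm_infty]
    split_ifs with hlt
    · left
      have hq : q.coeff d = 0 := Polynomial.coeff_eq_zero_of_natDegree_lt (lt_max_of_lt_left hlt)
      have hG0' : G = 0 := by rw [hG0, hy, map_zero, hm_infty, hq]; simp
      refine ⟨by simp [hq], ?_, rfl⟩
      exact hFG.resolve_right (by simp [hG0'])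
    · right
      have hdq : d = q.natDegree := max_eq_right (not_lt.1 hlt)
      have hq : q.coeff d ≠ 0 := by
        rw [hdq, Polynomial.coeff_natDegree, Ne, Polynomial.leadingCoeff_eq_zero]
        rintro rfl
        simp at hdq
        omega
      refine ⟨by simp [hq, hx'], ?_⟩
      rw [mul_div_mul_right _ _ (pow_ne_zero _ hx')]
  · have hy' : j y ≠ 0 := fun h => hy ((hj0 y).1 h)
    rw [hm_eval (le_max_left _ _) _ _ _ hy', hm_eval (le_max_right _ _) _ _ _ hy',
      mul_div_mul_left _ _ (pow_ne_zero _ hy'), mul_eq_zero, or_iff_right (pow_ne_zero _ hy')]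
    change _ ∨ ¬ _ ∧ (if _ then _ else _) = _
    by_cases h : (q.map (algebraMap K Ω)).eval (j x / j y) = 0
    · left
      have hG0' : G = 0 := by rw [hG0, hm_eval (le_max_right _ _) _ _ _ hy', h, mul_zero]
      exact ⟨h, hFG.resolve_right (by simp [hG0']), if_pos h⟩
    · right
      exact ⟨h, if_neg h⟩

lemma Amax_smul {L : Type*} [Field L] [NumberField L] (s x y : 𝓞 L) :
    Amax (s * x) (s * y) = Ideal.absNorm (Ideal.span {s}) * Amax x y := by
  rw [absNorm_eq_prod]
  unfold Amax
  rw [← Finset.prod_mul_distrib]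
  refine Finset.prod_congr rfl fun τ _ => ?_
  rw [mul_max_of_nonneg _ _ (norm_nonneg _)]
  simp

lemma absNorm_smul {L : Type*} [Field L] [NumberField L] (s x y : 𝓞 L) :
    Ideal.absNorm (Ideal.span {s * x, s * y}) =
      Ideal.absNorm (Ideal.span {s}) * Ideal.absNorm (Ideal.span {x, y}) := by
  rw [← map_mul, Ideal.span_mul_span', Set.singleton_mul, Set.image_pair]

lemma height_base {K : Type*} [Field K] [NumberField K] (α : K) :
    ∃ C : ℝ, 1 ≤ C ∧ ∀ (L : Type*) [Field L] [NumberField L] [Algebra K L]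
      (Ω : Type*) [Field Ω] [Algebra L Ω] [Algebra K Ω] [IsScalarTower K L Ω]
      (x y : 𝓞 L), HRep x y (OnePoint.some (algebraMap K Ω α)) →
      Amax x y ≤ C ^ Module.finrank ℚ L * Ideal.absNorm (Ideal.span {x, y}) := by
  obtain ⟨a, b, hb, rfl⟩ := IsFractionRing.div_surjective (A := 𝓞 K) α
  have hb0 : b ≠ 0 := nonZeroDivisors.ne_zero hb
  refine ⟨1 + ∑ ρ : K →+* ℂ, (‖ρ a‖ + ‖ρ b‖), ?_, ?_⟩
  · have : 0 ≤ ∑ ρ : K →+* ℂ, (‖ρ a‖ + ‖ρ b‖) := Finset.sum_nonneg fun ρ _ => by positivity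
    linarith
  intro L _ _ _ Ω _ _ _ _ x y hr
  rcases hr with ⟨-, -, h⟩ | ⟨hy, h⟩
  · exact absurd h (OnePoint.coe_ne_infty _)
  have h := OnePoint.coe_injective h
  set A := algebraMap (𝓞 K) (𝓞 L) a with hA
  set B := algebraMap (𝓞 K) (𝓞 L) b with hB
  have hB0 : B ≠ 0 := (map_ne_zero_iff _ (FaithfulSMul.algebraMap_injective _ _)).2 hb0
  have key : B * x = y * A := by
    apply RingOfIntegers.coe_injective
    apply (algebraMap L Ω).injective
    have e1 : algebraMap L Ω B = algebraMap K Ω b := by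
      rw [IsScalarTower.algebraMap_apply K L Ω]; rfl
    have e2 : algebraMap L Ω A = algebraMap K Ω a := by
      rw [IsScalarTower.algebraMap_apply K L Ω]; rfl
    have n1 : algebraMap K Ω b ≠ 0 := by
      rw [Ne, map_eq_zero]; exact_mod_cast hb0
    have n2 : algebraMap L Ω y ≠ 0 := by
      rw [Ne, map_eq_zero]; exact_mod_cast hy
    rw [map_div₀, div_eq_div_iff n1 n2] at h
    simp only [map_mul]
    change algebraMap L Ω B * _ = _ * algebraMap L Ω A
    rw [e1, e2, mul_comm _ (algebraMap L Ω x), mul_comm]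
    rw [mul_comm (algebraMap L Ω y)]
    first | exact h.symm | (rw [mul_comm]; exact h.symm)
  have hNB : (0:ℝ) < Ideal.absNorm (Ideal.span {B}) := by
    rw [Nat.cast_pos]
    apply Nat.pos_of_ne_zero
    rwa [Ne, Ideal.absNorm_eq_zero_iff, Ideal.span_singleton_eq_bot]
  have hAB : Amax A B ≤ (1 + ∑ ρ : K →+* ℂ, (‖ρ a‖ + ‖ρ b‖)) ^ Module.finrank ℚ L *
      Ideal.absNorm (Ideal.span {A, B}) := by
    have h1 : (1 : ℝ) ≤ Ideal.absNorm (Ideal.span {A, B}) := by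
      rw [Nat.one_le_cast]
      apply Nat.pos_of_ne_zero
      rw [Ne, Ideal.absNorm_eq_zero_iff, Ideal.span_eq_bot]
      simp [hB0]
    refine le_trans ?_ (le_mul_of_one_le_right (by positivity) h1)
    rw [← prod_const_emb]
    refine Finset.prod_le_prod (fun τ _ => by positivity) fun τ _ => ?_
    have := Finset.single_le_sum (f := fun ρ : K →+* ℂ => ‖ρ a‖ + ‖ρ b‖)
      (fun ρ _ => by positivity) (Finset.mem_univ (τ.comp (algebraMap K L)))
    have h1 : τ A = (τ.comp (algebraMap K L)) a := rfl
    have h2 : τ B = (τ.comp (algebraMap K L)) b := rfl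
    rw [h1, h2]
    have n1 := norm_nonneg ((τ.comp (algebraMap K L)) a)
    have n2 := norm_nonneg ((τ.comp (algebraMap K L)) b)
    exact max_le (by linarith) (by linarith)
  have k1 := Amax_smul B x y
  have k2 := Amax_smul y A B
  have k3 := absNorm_smul B x y
  have k4 := absNorm_smul y A B
  rw [key, mul_comm B y] at k1 k3
  rw [k2] at k1
  rw [k4] at k3
  have k3 : (Ideal.absNorm (Ideal.span {y}) : ℝ) * Ideal.absNorm (Ideal.span {A, B}) =
    Ideal.absNorm (Ideal.span {B}) * Ideal.absNorm (Ideal.span {x, y}) := by exact_mod_cast k3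
  refine le_of_mul_le_mul_left ?_ hNB
  rw [← k1, mul_left_comm, ← k3, mul_left_comm]
  gcongr

lemma height_bound {K : Type*} [Field K] [NumberField K] (p q : K[X]) (hcop : IsCoprime p q)
    (hdeg : 2 ≤ max p.natDegree q.natDegree) (α : K) :
    ∃ C : ℝ, 1 ≤ C ∧ ∀ (L : Type*) [Field L] [NumberField L] [Algebra K L]
      (Ω : Type*) [Field Ω] [Algebra L Ω] [Algebra K Ω] [IsScalarTower K L Ω] (n : ℕ)
      (P : OnePoint Ω), (onePointMap (p.map (algebraMap K Ω)) (q.map (algebraMap K Ω)))^[n] P =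
        OnePoint.some (algebraMap K Ω α) →
      ∀ (x y : 𝓞 L), HRep x y P →
      Amax x y ≤ C ^ Module.finrank ℚ L * Ideal.absNorm (Ideal.span {x, y}) := by
  obtain ⟨m, hm0, p0, q0, hp0, hq0, ⟨c⟩⟩ := exists_cert p q hcop
  obtain ⟨B, hB1, hB⟩ := exists_step c (by omega)
  obtain ⟨M, hM1, hM⟩ := height_base α
  refine ⟨max B M, le_max_of_le_left hB1, ?_⟩
  intro L _ _ _ Ω _ _ _ _ n
  induction n with
  | zero =>
    intro P hP x y hr
    simp only [Function.iterate_zero, id_eq] at hP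
    subst hP
    refine (hM L Ω x y hr).trans ?_
    gcongr
    exact le_max_right _ _
  | succ n ih =>
    intro P hP x y hr
    rw [Function.iterate_succ_apply] at hP
    have hs := rep_step p q m hm0 p0 q0 hp0 hq0 c (by omega) x y P hr
    have h1 := ih _ hP _ _ hs
    have h2 := hB L x y hr.ne
    set d := max p.natDegree q.natDegree
    set F := hm p0 d (algebraMap (𝓞 K) (𝓞 L)) x y
    set G := hm q0 d (algebraMap (𝓞 K) (𝓞 L)) x y
    set C := max B M with hC
    have hC1 : 1 ≤ C := le_max_of_le_left hB1
    have hN : (0:ℝ) < Ideal.absNorm (Ideal.span {F, G}) := by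
      rw [Nat.cast_pos]
      apply Nat.pos_of_ne_zero
      rw [Ne, Ideal.absNorm_eq_zero_iff, Ideal.span_eq_bot]
      have := hs.ne
      simp; tauto
    refine le_of_pow_le_pow_left₀ (n := d) (by omega) (by positivity) ?_
    refine le_of_mul_le_mul_right ?_ hN
    refine h2.trans ?_
    have h3 : B ^ Module.finrank ℚ L * C ^ Module.finrank ℚ L ≤ (C ^ Module.finrank ℚ L) ^ d := by
      calc _ ≤ C ^ Module.finrank ℚ L * C ^ Module.finrank ℚ L := by
            gcongr; exact le_max_left _ _
        _ = (C ^ Module.finrank ℚ L) ^ 2 := by ring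
        _ ≤ _ := pow_le_pow_right₀ (one_le_pow₀ hC1) hdeg
    calc _ ≤ B ^ Module.finrank ℚ L * (C ^ Module.finrank ℚ L * Ideal.absNorm (Ideal.span {F, G})) *
          Ideal.absNorm (Ideal.span {x, y}) ^ d := by gcongr
      _ = (B ^ Module.finrank ℚ L * C ^ Module.finrank ℚ L) * (Ideal.absNorm (Ideal.span {F, G}) *
          Ideal.absNorm (Ideal.span {x, y}) ^ d) := by ring
      _ ≤ (C ^ Module.finrank ℚ L) ^ d * (Ideal.absNorm (Ideal.span {F, G}) *
          Ideal.absNorm (Ideal.span {x, y}) ^ d) := by gcongr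
      _ = _ := by rw [mul_pow]; ring

lemma Amax_galois {K L : Type*} [Field K] [NumberField K] [Field L] [NumberField L] [Algebra K L]
    (σ : Gal(L/K)) (x y : 𝓞 L) : Amax (σ • x) (σ • y) = Amax x y := by
  unfold Amax
  let e : (L →+* ℂ) ≃ (L →+* ℂ) :=
    { toFun := fun τ => τ.comp (σ : L →+* L)
      invFun := fun τ => τ.comp (σ.symm : L →+* L)
      left_inv := fun τ => by ext z; simp
      right_inv := fun τ => by ext z; simp }
  refine Fintype.prod_equiv e _ _ fun τ => ?_
  rfl

lemma D_bound {K L : Type*} [Field K] [NumberField K] [Field L] [NumberField L] [Algebra K L]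
    (σ : Gal(L/K)) (x y : 𝓞 L) :
    (Ideal.absNorm (Ideal.span {x * σ • y - y * σ • x}) : ℝ) ≤
      2 ^ Module.finrank ℚ L * Amax x y ^ 2 := by
  rw [sq]
  nth_rewrite 2 [← Amax_galois σ x y]
  unfold Amax
  rw [absNorm_eq_prod, ← prod_const_emb, ← Finset.prod_mul_distrib, ← Finset.prod_mul_distrib]
  refine Finset.prod_le_prod (fun τ _ => norm_nonneg _) fun τ _ => ?_
  have e : τ ((x * σ • y - y * σ • x : 𝓞 L) : L) =
      τ x * τ (σ • y : 𝓞 L) - τ y * τ (σ • x : 𝓞 L) := by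
    simp
  rw [e]
  refine (norm_sub_le _ _).trans ?_
  rw [norm_mul, norm_mul, two_mul]
  set a := ‖τ x‖
  set b := ‖τ y‖
  set c := ‖τ (σ • x : 𝓞 L)‖ with hc
  set d := ‖τ (σ • y : 𝓞 L)‖ with hd
  have hc0 : 0 ≤ c := norm_nonneg _
  have hd0 : 0 ≤ d := norm_nonneg _
  have h1 : a * d ≤ max a b * max c d :=
    mul_le_mul (le_max_left _ _) (le_max_right _ _) hd0 ((norm_nonneg _).trans (le_max_left _ _))
  have h2 : b * c ≤ max a b * max c d :=
    mul_le_mul (le_max_right _ _) (le_max_left _ _) hc0 ((norm_nonneg _).trans (le_max_left _ _))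
  linarith

lemma core_bound {K L : Type*} [Field K] [NumberField K] [Field L] [NumberField L] [Algebra K L]
    [IsAbelianGalois K L] (p : Ideal (𝓞 K)) [p.IsMaximal] (hp : p ≠ ⊥) (P : Ideal (𝓞 L)) [P.IsPrime]
    [P.LiesOver p] (σ : Gal(L/K)) (hσ : σ ∈ P.inertia Gal(L/K)) (x y : 𝓞 L)
    (h : x ≠ 0 ∨ y ≠ 0) (hD : x * σ • y - y * σ • x ≠ 0) (C : ℝ) (hC : 1 ≤ C)
    (hA : Amax x y ≤ C ^ Module.finrank ℚ L * Ideal.absNorm (Ideal.span {x, y}))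
    (d : ℕ) (hd : Nat.card (P.inertia Gal(L/K)) ≤ d) :
    (Ideal.absNorm p : ℝ) ≤ (2 * C ^ 2) ^ (d * Module.finrank ℚ K) := by
  have h1 := normBound K L p hp P σ hσ x y h hD
  have h1 : (Ideal.absNorm (Ideal.span {x, y}) : ℝ) ^ 2 *
      Ideal.absNorm (∏ Q ∈ p.primesOver (𝓞 L), Q) ≤
        Ideal.absNorm (Ideal.span {x * σ • y - y * σ • x}) := by exact_mod_cast h1
  have h2 := h1.trans (D_bound σ x y)
  have hN : (0:ℝ) < Ideal.absNorm (Ideal.span {x, y}) := by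
    rw [Nat.cast_pos]
    apply Nat.pos_of_ne_zero
    rw [Ne, Ideal.absNorm_eq_zero_iff, Ideal.span_eq_bot]
    simp; tauto
  have h3 : (Ideal.absNorm (∏ Q ∈ p.primesOver (𝓞 L), Q) : ℝ) ≤
      (2 * C ^ 2) ^ Module.finrank ℚ L := by
    refine le_of_mul_le_mul_left ?_ (pow_pos hN 2)
    refine h2.trans ?_
    calc _ ≤ 2 ^ Module.finrank ℚ L *
          (C ^ Module.finrank ℚ L * Ideal.absNorm (Ideal.span {x, y})) ^ 2 := by
          gcongr
          exact Amax_nonneg _ _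
      _ = _ := by rw [mul_pow, mul_pow, ← pow_mul, ← pow_mul, mul_comm 2]; ring
  have h4 := congrArg Ideal.absNorm (galPow K L p hp P)
  rw [Ideal.absNorm_algebraMap (𝓞 K) (𝓞 L) p, map_pow] at h4
  have hfr : Module.finrank (𝓞 K) (𝓞 L) = Module.finrank K L :=
    (IsFractionRing.finrank_eq (𝓞 K) K (𝓞 L) L).symm
  rw [hfr] at h4
  have hK : 0 < Module.finrank K L := Module.finrank_pos
  have h2C : 1 ≤ 2 * C ^ 2 := by nlinarith
  refine le_of_pow_le_pow_left₀ hK.ne' (by positivity) ?_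
  have h4 : (Ideal.absNorm p : ℝ) ^ Module.finrank K L =
    (Ideal.absNorm (∏ Q ∈ p.primesOver (𝓞 L), Q) : ℝ) ^ Nat.card (P.inertia Gal(L/K)) := by
    exact_mod_cast h4
  rw [h4]
  calc _ ≤ ((2 * C ^ 2) ^ Module.finrank ℚ L) ^ Nat.card (P.inertia Gal(L/K)) := by gcongr
    _ ≤ ((2 * C ^ 2) ^ Module.finrank ℚ L) ^ d := pow_le_pow_right₀ (one_le_pow₀ h2C) hd
    _ = _ := by
      rw [← Module.finrank_mul_finrank ℚ K L, ← pow_mul, ← pow_mul]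
      congr 1; ring

lemma inertia_fix {K E L : Type*} [Field K] [NumberField K] [Field L] [NumberField L] [Algebra K L]
    [Field E] [NumberField E] [Algebra K E] [Algebra E L] [IsScalarTower K E L]
    [IsGalois K L] [IsGalois K E] (p : Ideal (𝓞 K)) [p.IsMaximal] (hp : p ≠ ⊥)
    (P : Ideal (𝓞 L)) [P.IsPrime] [P.LiesOver p]
    (hE : Squarefree (Ideal.map (algebraMap (𝓞 K) (𝓞 E)) p))
    (σ : Gal(L/K)) (hσ : σ ∈ P.inertia Gal(L/K)) (z : E) :
    σ (algebraMap E L z) = algebraMap E L z := by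
  have : (P.under (𝓞 E)).LiesOver p := inferInstance
  rw [galSqf K E p hp (P.under (𝓞 E))] at hE
  have hτ : σ.restrictNormal E ∈ (P.under (𝓞 E)).inertia Gal(E/K) := by
    intro w
    change algebraMap (𝓞 E) (𝓞 L) _ ∈ P
    have h1 := hσ (algebraMap (𝓞 E) (𝓞 L) w)
    have h2 : algebraMap (𝓞 E) (𝓞 L) (σ.restrictNormal E • w) =
        σ • algebraMap (𝓞 E) (𝓞 L) w := by
      apply RingOfIntegers.coe_injective
      exact AlgEquiv.restrictNormal_commutes σ E w
    rw [map_sub, h2]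
    exact h1
  have h1 : σ.restrictNormal E = 1 := by
    have := (Nat.card_eq_one_iff_unique.1 hE).1
    exact congrArg Subtype.val (Subsingleton.elim
      (⟨_, hτ⟩ : (P.under (𝓞 E)).inertia Gal(E/K)) 1)
  rw [← AlgEquiv.restrictNormal_commutes, h1]
  rfl

lemma card_le_of_roots {K L : Type*} [Field K] [Field L] [Algebra K L] (β : L) (hβ : K⟮β⟯ = ⊤)
    (H : Subgroup Gal(L/K)) (f : L[X]) (hf : f ≠ 0) (h : ∀ σ ∈ H, f.eval (σ β) = 0) :
    Nat.card H ≤ f.natDegree := by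
  have hinj : ∀ σ τ : Gal(L/K), σ β = τ β → σ = τ := by
    intro σ τ hst
    ext z
    have hz : z ∈ K⟮β⟯ := by rw [hβ]; trivial
    induction hz using IntermediateField.adjoin_induction with
    | mem x hx => rw [Set.mem_singleton_iff.1 hx, hst]
    | algebraMap x => simp
    | add x y _ _ hx hy => rw [map_add, map_add, hx, hy]
    | inv x _ hx => rw [map_inv₀, map_inv₀, hx]
    | mul x y _ _ hx hy => rw [map_mul, map_mul, hx, hy]
  let g : H → f.roots.toFinset := fun σ => ⟨σ.1 β, by simp [hf, h σ.1 σ.2]⟩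
  have hg : Function.Injective g := by
    intro σ τ hst
    exact Subtype.ext (hinj _ _ (congrArg Subtype.val hst))
  calc Nat.card H ≤ Nat.card f.roots.toFinset := Nat.card_le_card_of_injective g hg
    _ = f.roots.toFinset.card := Nat.card_eq_finsetCard _
    _ ≤ _ := (Multiset.toFinset_card_le _).trans (Polynomial.card_roots' f)

lemma step_bound {K L : Type*} [Field K] [NumberField K] [Field L] [NumberField L] [Algebra K L]
    [IsAbelianGalois K L] (p q : K[X]) (hcop : IsCoprime p q)
    (hdeg : 0 < max p.natDegree q.natDegree) (β : L) (hβ : K⟮β⟯ = ⊤)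
    (𝔭 : Ideal (𝓞 K)) [𝔭.IsMaximal] (hp : 𝔭 ≠ ⊥)
    (hram : ¬ Squarefree (Ideal.map (algebraMap (𝓞 K) (𝓞 L)) 𝔭))
    (hfix : aeval β q ≠ 0 → ∀ (P : Ideal (𝓞 L)) [P.IsPrime] [P.LiesOver 𝔭],
      ∀ σ ∈ P.inertia Gal(L/K), σ (aeval β p / aeval β q) = aeval β p / aeval β q)
    (B : ℝ) (hB : 1 ≤ B)
    (hA : ∀ x y : 𝓞 L, y ≠ 0 → β = (x : L) / y →
      Amax x y ≤ B ^ Module.finrank ℚ L * Ideal.absNorm (Ideal.span {x, y})) :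
    (Ideal.absNorm 𝔭 : ℝ) ≤
      (2 * B ^ 2) ^ (max p.natDegree q.natDegree * Module.finrank ℚ K) := by
  obtain ⟨P, hP1, hP2⟩ := Ideal.exists_maximal_ideal_liesOver_of_isIntegral (S := 𝓞 L) 𝔭
  have hPp := hP1.isPrime
  have hcard : Nat.card (P.inertia Gal(L/K)) ≤ max p.natDegree q.natDegree := by
    by_cases hq : aeval β q = 0
    · have hq0 : q ≠ 0 := by
        rintro rfl
        rw [isCoprime_zero_right] at hcop
        simp [Polynomial.natDegree_eq_zero_of_isUnit hcop] at hdeg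
      have := card_le_of_roots β hβ (P.inertia Gal(L/K)) (q.map (algebraMap K L))
        ((Polynomial.map_ne_zero_iff (algebraMap K L).injective).2 hq0) (fun σ _ => by
          rw [Polynomial.eval_map_algebraMap, Polynomial.aeval_algHom_apply σ β q, hq, map_zero])
      rw [Polynomial.natDegree_map] at this
      exact this.trans (le_max_right _ _)
    · have hz := hfix hq P
      set z := aeval β p / aeval β q with hzdef
      have hpz : aeval β p = z * aeval β q := by rw [hzdef, div_mul_cancel₀ _ hq]
      have hf0 : p.map (algebraMap K L) - C z * q.map (algebraMap K L) ≠ 0 := by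
        intro h0
        rw [sub_eq_zero] at h0
        have hc := hcop.map (Polynomial.mapRingHom (algebraMap K L))
        simp only [Polynomial.coe_mapRingHom] at hc
        have hu : IsUnit (q.map (algebraMap K L)) := by
          rw [h0] at hc
          exact hc.isUnit_of_dvd' (Dvd.intro_left _ rfl) dvd_rfl
        have hq0 : q.natDegree = 0 := by
          rw [← Polynomial.natDegree_map (algebraMap K L)]
          exact Polynomial.natDegree_eq_zero_of_isUnit hu
        have hp0 : p.natDegree = 0 := by
          have := Polynomial.natDegree_C_mul_le z (q.map (algebraMap K L))
          rw [← h0, Polynomial.natDegree_map, Polynomial.natDegree_map] at this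
          omega
        simp [hq0, hp0] at hdeg
      have := card_le_of_roots β hβ (P.inertia Gal(L/K)) _ hf0 (fun σ hσ => by
          rw [Polynomial.eval_sub, Polynomial.eval_mul, Polynomial.eval_C,
            Polynomial.eval_map_algebraMap, Polynomial.eval_map_algebraMap,
            Polynomial.aeval_algHom_apply σ β q, Polynomial.aeval_algHom_apply σ β p, hpz, map_mul,
            hz σ hσ, sub_self])
      refine this.trans ((Polynomial.natDegree_sub_le _ _).trans (max_le_max ?_ ?_))
      · rw [Polynomial.natDegree_map]
      · refine (Polynomial.natDegree_C_mul_le _ _).trans ?_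
        rw [Polynomial.natDegree_map]
  obtain ⟨x, y, hy, hxy⟩ := IsFractionRing.div_surjective (A := 𝓞 L) β
  have hy0 : y ≠ 0 := nonZeroDivisors.ne_zero hy
  have hyL : (y : L) ≠ 0 := by exact_mod_cast hy0
  obtain ⟨σ, hσ, hσ1⟩ : ∃ σ ∈ P.inertia Gal(L/K), σ ≠ 1 := by
    by_contra! hall
    refine hram ((galSqf K L 𝔭 hp P).2 ?_)
    have hbot : P.inertia Gal(L/K) = ⊥ := (Subgroup.eq_bot_iff_forall _).2 hall
    exact Subgroup.card_eq_one.2 hbot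
  refine core_bound 𝔭 hp P σ hσ x y (Or.inr hy0) ?_ B hB (hA x y hy0 hxy.symm) _ hcard
  intro hD
  apply hσ1
  have hD' : (x : L) * σ y - y * σ x = 0 := by
    have := congrArg (algebraMap (𝓞 L) L) hD
    rw [map_sub, map_mul, map_mul, map_zero] at this
    exact this
  have hσy : σ (y : L) ≠ 0 := by simpa using hyL
  have hfixβ : σ β = β := by
    rw [← hxy, map_div₀]
    change σ (x : L) / σ (y : L) = (x : L) / (y : L)
    rw [div_eq_div_iff hσy hyL]
    linear_combination -hD'
  have h1 : Nat.card (Subgroup.zpowers σ) ≤ (X - C β : L[X]).natDegree := by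
    refine card_le_of_roots β hβ _ _ (Polynomial.X_sub_C_ne_zero β) fun τ hτ => ?_
    have : τ ∈ MulAction.stabilizer Gal(L/K) β := by
      refine (Subgroup.zpowers_le.2 ?_) hτ
      exact hfixβ
    have h2 : τ β = β := this
    simp [h2]
  rw [Polynomial.natDegree_X_sub_C, Nat.card_zpowers] at h1
  have := orderOf_pos σ
  exact orderOf_eq_one_iff.1 (by omega)

lemma sqf_map {A B : Type*} [CommRing A] [CommRing B] (e : A ≃+* B) (I : Ideal A)
    (h : Squarefree I) : Squarefree (I.map (e : A →+* B)) := by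
  have h1 : ∀ J : Ideal B, (J.map (e.symm : B →+* A)).map (e : A →+* B) = J := fun J => by
    rw [Ideal.map_map]; simp
  have h2 : (I.map (e : A →+* B)).map (e.symm : B →+* A) = I := by
    rw [Ideal.map_map]; simp
  intro J hJ
  have h3 := map_dvd (Ideal.mapHom (e.symm : B →+* A)) hJ
  rw [map_mul] at h3
  simp only [Ideal.mapHom_apply] at h3
  rw [h2] at h3
  have h4 := (h _ h3).map (Ideal.mapHom (e : A →+* B))
  simp only [Ideal.mapHom_apply] at h4
  rwa [h1] at h4

lemma isRamifiedIn_iff (K L : Type*) [Field K] [NumberField K] [Field L] [NumberField L]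
    [Algebra K L] (𝔭 : Ideal (𝓞 K)) :
    IsRamifiedIn K L 𝔭 ↔ ¬ Squarefree (Ideal.map (algebraMap (𝓞 K) (𝓞 L)) 𝔭) := by
  unfold IsRamifiedIn
  let _ : Algebra (𝓞 K) L := ((algebraMap K L).comp (algebraMap (𝓞 K) K)).toAlgebra
  have : IsScalarTower (𝓞 K) K L := IsScalarTower.of_algebraMap_eq fun _ => rfl
  have hi : ∀ z : L, z ∈ integralClosure (𝓞 K) L ↔ z ∈ integralClosure ℤ L := by
    intro z
    have : IsScalarTower ℤ (𝓞 K) L := IsScalarTower.of_algebraMap_eq fun n => by simp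
    constructor
    · intro hz
      exact isIntegral_trans (R := ℤ) (A := 𝓞 K) z hz
    · intro hz
      exact IsIntegral.tower_top (A := 𝓞 K) hz
  let e : integralClosure (𝓞 K) L ≃+* 𝓞 L :=
    { toFun := fun z => ⟨z.1, (hi _).1 z.2⟩
      invFun := fun z => ⟨z.1, (hi _).2 z.2⟩
      left_inv := fun _ => rfl
      right_inv := fun _ => rfl
      map_mul' := fun _ _ => rfl
      map_add' := fun _ _ => rfl }
  have h1 : (Ideal.map (algebraMap (𝓞 K) (integralClosure (𝓞 K) L)) 𝔭).map
      (e : integralClosure (𝓞 K) L →+* 𝓞 L) = Ideal.map (algebraMap (𝓞 K) (𝓞 L)) 𝔭 := by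
    rw [Ideal.map_map]; rfl
  have h2 : (Ideal.map (algebraMap (𝓞 K) (𝓞 L)) 𝔭).map
      (e.symm : 𝓞 L →+* integralClosure (𝓞 K) L) =
      Ideal.map (algebraMap (𝓞 K) (integralClosure (𝓞 K) L)) 𝔭 := by
    rw [Ideal.map_map]; rfl
  refine not_congr ⟨fun h => ?_, fun h => ?_⟩
  · rw [← h1]; exact sqf_map e _ h
  · have := sqf_map e.symm _ h
    rw [h2] at this
    exact this

lemma not_ramified_base (K Ω : Type*) [Field K] [NumberField K] [Field Ω] [Algebra K Ω]
    (α : K) (𝔭 : Ideal (𝓞 K)) [h𝔭 : 𝔭.IsMaximal] (hp : 𝔭 ≠ ⊥) [NumberField K⟮algebraMap K Ω α⟯] :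
    Squarefree (Ideal.map (algebraMap (𝓞 K) (𝓞 K⟮algebraMap K Ω α⟯)) 𝔭) := by
  have hs : Function.Surjective (algebraMap K K⟮algebraMap K Ω α⟯) := by
    intro z
    have hbot : K⟮algebraMap K Ω α⟯ = ⊥ :=
      IntermediateField.adjoin_simple_eq_bot_iff.2 (IntermediateField.mem_bot.2 ⟨α, rfl⟩)
    obtain ⟨w, hw⟩ := IntermediateField.mem_bot.1 (hbot.le z.2)
    exact ⟨w, Subtype.ext hw⟩
  have hs' : Function.Surjective (algebraMap (𝓞 K) (𝓞 K⟮algebraMap K Ω α⟯)) := by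
    intro z
    obtain ⟨w, hw⟩ := hs z
    have hwi : IsIntegral ℤ w := by
      have h1 : IsIntegral ℤ (algebraMap K K⟮algebraMap K Ω α⟯ w) := by rw [hw]; exact z.2
      exact (isIntegral_algebraMap_iff (algebraMap K K⟮algebraMap K Ω α⟯).injective).1 h1
    refine ⟨⟨w, hwi⟩, ?_⟩
    apply RingOfIntegers.coe_injective
    exact hw
  let e := RingEquiv.ofBijective (algebraMap (𝓞 K) (𝓞 K⟮algebraMap K Ω α⟯))
    ⟨FaithfulSMul.algebraMap_injective _ _, hs'⟩
  have h1 : Squarefree 𝔭 := (Ideal.prime_of_isPrime hp h𝔭.isPrime).squarefree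
  exact sqf_map e 𝔭 h1

lemma main_bound {K : Type*} [Field K] [NumberField K] (p q : K[X]) (hcop : IsCoprime p q)
    (hdeg : 2 ≤ max p.natDegree q.natDegree) (α : K) :
    ∃ B : ℝ, ∀ (Ω : Type*) [Field Ω] [Algebra K Ω] [Algebra.IsAlgebraic K Ω]
      (𝔭 : Ideal (𝓞 K)) [𝔭.IsMaximal], 𝔭 ≠ ⊥ → ∀ (n : ℕ) (γ : Ω) [NumberField K⟮γ⟯]
      [IsAbelianGalois K K⟮γ⟯],
      (onePointMap (p.map (algebraMap K Ω)) (q.map (algebraMap K Ω)))^[n] (OnePoint.some γ) =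
        OnePoint.some (algebraMap K Ω α) →
      ¬ Squarefree (Ideal.map (algebraMap (𝓞 K) (𝓞 K⟮γ⟯)) 𝔭) → (Ideal.absNorm 𝔭 : ℝ) ≤ B := by
  obtain ⟨C, hC1, hC⟩ := height_bound p q hcop hdeg α
  refine ⟨(2 * C ^ 2) ^ (max p.natDegree q.natDegree * Module.finrank ℚ K), ?_⟩
  intro Ω _ _ _ 𝔭 _ hp n
  induction n with
  | zero =>
    intro γ _ _ hγ hram
    simp only [Function.iterate_zero, id_eq] at hγ
    obtain rfl := OnePoint.coe_injective hγ
    exact absurd (not_ramified_base K Ω α 𝔭 hp) hram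
  | succ n ih =>
    intro γ _ _ hγ hram
    by_contra hlt
    apply hlt
    set β : K⟮γ⟯ := IntermediateField.AdjoinSimple.gen K γ with hβdef
    have hβγ : algebraMap K⟮γ⟯ Ω β = γ := IntermediateField.AdjoinSimple.algebraMap_gen K γ
    have hβ : K⟮β⟯ = ⊤ := by
      apply IntermediateField.lift_injective K⟮γ⟯
      rw [IntermediateField.lift_adjoin_simple, IntermediateField.lift_top]
      rfl
    refine step_bound p q hcop (by omega) β hβ 𝔭 hp hram ?_ C hC1 ?_
    · intro hq P _ _ σ hσ
      have hqγ : (q.map (algebraMap K Ω)).eval γ ≠ 0 := by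
        rw [Polynomial.eval_map_algebraMap, ← hβγ, Polynomial.aeval_algebraMap_apply, Ne, map_eq_zero]
        exact hq
      set z : Ω := (p.map (algebraMap K Ω)).eval γ / (q.map (algebraMap K Ω)).eval γ with hz
      have hzβ : algebraMap K⟮γ⟯ Ω (aeval β p / aeval β q) = z := by
        rw [map_div₀, ← Polynomial.aeval_algebraMap_apply, ← Polynomial.aeval_algebraMap_apply, hβγ,
          hz, Polynomial.eval_map_algebraMap, Polynomial.eval_map_algebraMap]
      have hle : K⟮z⟯ ≤ K⟮γ⟯ := by
        rw [IntermediateField.adjoin_simple_le_iff, ← hzβ]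
        exact (aeval β p / aeval β q : K⟮γ⟯).2
      have hfin : FiniteDimensional K K⟮z⟯ :=
        IntermediateField.adjoin.finiteDimensional (Algebra.IsIntegral.isIntegral z)
      have hnf : NumberField K⟮z⟯ := NumberField.of_module_finite K K⟮z⟯
      have hab : IsAbelianGalois K K⟮z⟯ := IsAbelianGalois.of_algHom (IntermediateField.inclusion hle)
      have hit : (onePointMap (p.map (algebraMap K Ω)) (q.map (algebraMap K Ω)))^[n]
          (OnePoint.some z) = OnePoint.some (algebraMap K Ω α) := by
        rw [Function.iterate_succ_apply] at hγ
        rw [← hγ]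
        congr 1
        exact (if_neg hqγ).symm
      have hsq : Squarefree (Ideal.map (algebraMap (𝓞 K) (𝓞 K⟮z⟯)) 𝔭) := by
        by_contra h
        exact hlt (ih z hit h)
      let _ : Algebra K⟮z⟯ K⟮γ⟯ := (IntermediateField.inclusion hle).toRingHom.toAlgebra
      have : IsScalarTower K K⟮z⟯ K⟮γ⟯ :=
        IsScalarTower.of_algebraMap_eq' (IntermediateField.inclusion hle).comp_algebraMap.symm
      have hfx := inertia_fix 𝔭 hp P hsq σ hσ (IntermediateField.AdjoinSimple.gen K z)
      have hg : algebraMap K⟮z⟯ K⟮γ⟯ (IntermediateField.AdjoinSimple.gen K z) =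
          aeval β p / aeval β q := by
        apply Subtype.ext
        exact hzβ.symm
      rwa [hg] at hfx
    · intro x y hy hxy
      refine hC K⟮γ⟯ Ω (n + 1) (OnePoint.some γ) hγ x y (Or.inr ⟨hy, ?_⟩)
      rw [← map_div₀, ← hxy, hβγ]

/-- Let `K` be a number field, `φ = p/q ∈ K(x)` of degree `≥ 2`, and
`α ∈ K`. Then only finitely many primes of `K` ramify in the extension `K_∞^{ab}(φ,α)/K`
generated by all points of the backward orbit of `α` lying in abelian extensions of `K`. -/
theorem finitely_many_ramified_primes_in_abelian_part
    (K : Type*) [Field K] [NumberField K]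
    (p q : Polynomial K) (hcop : IsCoprime p q)
    (hdeg : 2 ≤ max p.natDegree q.natDegree) (α : K) :
    {𝔭 : Ideal (𝓞 K) | 𝔭.IsMaximal ∧
      ∃ γ ∈ backOrbit (p.map (algebraMap K (AlgebraicClosure K)))
          (q.map (algebraMap K (AlgebraicClosure K)))
          (algebraMap K (AlgebraicClosure K) α),
        (IsGalois K K⟮γ⟯ ∧ ∀ σ τ : K⟮γ⟯ ≃ₐ[K] K⟮γ⟯, σ * τ = τ * σ) ∧
          IsRamifiedIn K K⟮γ⟯ 𝔭}.Finite := by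
  obtain ⟨B, hB⟩ := main_bound p q hcop hdeg α
  refine ((Ideal.finite_setOfPred_absNorm_le (S := 𝓞 K) ⌊B⌋₊).union
    (Set.finite_singleton (⊥ : Ideal (𝓞 K)))).subset ?_
  rintro 𝔭 ⟨hmax, γ, ⟨n, -, hn⟩, ⟨hgal, hcomm⟩, hram⟩
  by_cases hp : 𝔭 = ⊥
  · right; exact hp
  left
  have hfin : FiniteDimensional K K⟮γ⟯ :=
    IntermediateField.adjoin.finiteDimensional (Algebra.IsIntegral.isIntegral γ)
  have hnf : NumberField K⟮γ⟯ := NumberField.of_module_finite K K⟮γ⟯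
  have hab : IsAbelianGalois K K⟮γ⟯ := { hgal with is_comm := ⟨hcomm⟩ }
  rw [isRamifiedIn_iff] at hram
  exact Nat.le_floor (hB (AlgebraicClosure K) 𝔭 hp n γ hn hram)
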